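/- Suppose 0 < β < 1/(2N+1). Let t = (t_0, t_1, …, t_m) ∈ T^{m+1} with 0 = t_0 < t_1 < … < t_m, and let g(x) = −r x + b with 0 < r < 1. If g(Γ_t) ⊆ Γ, then g(x) = φ_i(1 − x) for some word i ∈ Ω̂_t^n with n ≥ τ_t. -/

import Mathlib

noncomputable section

namespace HSCantor

/-- A `D`-coding of `x`: a digit sequence `c` with digits in `D ⊆ ℤ` such that
`x = (1-β)/N · Σ_{k=1}^∞ c_k β^{k-1}` (here indexed from `k = 0`). -/
def IsCoding (N : ℕ) (β : ℝ) (D : Set ℤ) (x : ℝ) (c : ℕ → ℤ) : Prop :=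
  (∀ k, c k ∈ D) ∧ x = (1 - β) / N * ∑' k : ℕ, (c k : ℝ) * β ^ k

/-- The set `Γ_{β,D}` for a digit set `D ⊆ ℤ`. -/
def cantorD (N : ℕ) (β : ℝ) (D : Set ℤ) : Set ℝ := { x | ∃ c, IsCoding N β D x c }

/-- The homogeneous symmetric Cantor set `Γ = Γ_{β,{0,1,…,N}}`. -/
def Gamma (N : ℕ) (β : ℝ) : Set ℝ := cantorD N β (Set.Icc 0 (N : ℤ))

/-- `E ⊆ ℝ` is a self-similar set: it is nonempty, compact, and is the union of its
images under finitely many contracting similitudes `x ↦ r x + b`, `0 < |r| < 1`. -/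
def IsSelfSimilar (E : Set ℝ) : Prop :=
  E.Nonempty ∧ IsCompact E ∧ ∃ F : Finset (ℝ × ℝ),
    (∀ p ∈ F, 0 < |p.1| ∧ |p.1| < 1) ∧
    E = ⋃ p ∈ F, (fun x => p.1 * x + p.2) '' E

/-- `Γ_t = ⋃_{j=0}^m (Γ + t_j)`. -/
def GammaT (N : ℕ) (β : ℝ) {m : ℕ} (t : Fin (m + 1) → ℝ) : Set ℝ :=
  ⋃ j, (fun x => x + t j) '' Gamma N β

/-- The set `T = ⋃_{n≥1} { (1-β)/N · Σ_{k=1}^n j_k β^{-k} : j_k ∈ {0,…,N} }`. -/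
def Tset (N : ℕ) (β : ℝ) : Set ℝ :=
  { x | ∃ n : ℕ, 1 ≤ n ∧ ∃ c : ℕ → ℕ, (∀ k, c k ≤ N) ∧
      x = (1 - β) / N * ∑ k ∈ Finset.Icc 1 n, (c k : ℝ) * β ^ (-(k : ℤ)) }

/-- `d` is a digit representation of the translation vector `t` with `τ` digits:
`t_j = (1-β)/N · Σ_{k=1}^τ d_{j,k} β^{-k}` with all digits in `{0,…,N}`. -/
def IsDigitRep (N : ℕ) (β : ℝ) {m : ℕ} (t : Fin (m + 1) → ℝ) (τ : ℕ)
    (d : Fin (m + 1) → ℕ → ℕ) : Prop :=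
  (∀ j k, d j k ≤ N) ∧
    ∀ j, t j = (1 - β) / N * ∑ k ∈ Finset.Icc 1 τ, (d j k : ℝ) * β ^ (-(k : ℤ))

/-- `d` is a digit representation of `t` with `τ = τ_t` digits, `τ_t` minimal. -/
def IsMinimalRep (N : ℕ) (β : ℝ) {m : ℕ} (t : Fin (m + 1) → ℝ) (τ : ℕ)
    (d : Fin (m + 1) → ℕ → ℕ) : Prop :=
  IsDigitRep N β t τ d ∧ ∀ τ' < τ, ∀ d', ¬ IsDigitRep N β t τ' d'

/-- `s_k = max_{0 ≤ j ≤ m} t_{j,k}`. -/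
def digitSup {m : ℕ} (d : Fin (m + 1) → ℕ → ℕ) (k : ℕ) : ℕ :=
  Finset.univ.sup fun j => d j k

/-- Words of length `n` over the alphabet `{0,1,…,N}`, as lists of naturals. -/
def Words (N n : ℕ) : Set (List ℕ) := { w | w.length = n ∧ ∀ x ∈ w, x ≤ N }

/-- `Ω_t^n`: words `i_1 … i_n ∈ {0,…,N}^n` with `i_{n+1-k} ≤ N - s_k` for `1 ≤ k ≤ τ`.
(A list `w = [i_1, …, i_n]` satisfies `i_{n+1-k} = w.getD (n-k) 0`.) -/
def Omega (N τ : ℕ) (s : ℕ → ℕ) (n : ℕ) : Set (List ℕ) :=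
  { w | w ∈ Words N n ∧ ∀ k, 1 ≤ k → k ≤ τ → w.getD (n - k) 0 + s k ≤ N }

/-- `Ω̂_t^n`: words `i_1 … i_n ∈ {0,…,N}^n` with `i_{n+1-k} ≥ s_k` for `1 ≤ k ≤ τ`. -/
def OmegaHat (N τ : ℕ) (s : ℕ → ℕ) (n : ℕ) : Set (List ℕ) :=
  { w | w ∈ Words N n ∧ ∀ k, 1 ≤ k → k ≤ τ → s k ≤ w.getD (n - k) 0 }

/-- `W_t^τ = A_t^τ ∪ Â_t^τ`: words obtained from a word in `Ω_t^τ` (resp. `Ω̂_t^τ`)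
by adding (resp. subtracting) the digits of some `t_j` to the last `τ` positions. -/
def Wset (N : ℕ) {m : ℕ} (τ : ℕ) (d : Fin (m + 1) → ℕ → ℕ) : Set (List ℕ) :=
  { v | ∃ w ∈ Omega N τ (digitSup d) τ, ∃ j : Fin (m + 1),
      v = List.ofFn fun idx : Fin τ => w.getD idx 0 + d j (τ - (idx : ℕ)) } ∪
  { v | ∃ w ∈ OmegaHat N τ (digitSup d) τ, ∃ j : Fin (m + 1),
      v = List.ofFn fun idx : Fin τ => w.getD idx 0 - d j (τ - (idx : ℕ)) }

/-- The symbolic admissibility condition: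
`⋃_{n=τ}^ℓ {0,…,N}^{n-τ} × W_t^τ × {0,…,N}^{ℓ-n} = {0,…,N}^ℓ` for some `ℓ ≥ τ`. -/
def AdmissibleWith (N : ℕ) {m : ℕ} (τ : ℕ) (d : Fin (m + 1) → ℕ → ℕ) : Prop :=
  ∃ ℓ, τ ≤ ℓ ∧
    (⋃ n ∈ Finset.Icc τ ℓ,
      { z : List ℕ | ∃ u ∈ Words N (n - τ), ∃ w ∈ Wset N τ d, ∃ v ∈ Words N (ℓ - n),
          z = u ++ w ++ v }) = Words N ℓ

/-- `t` is an admissible translation vector. -/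
def IsAdmissible (N : ℕ) (β : ℝ) {m : ℕ} (t : Fin (m + 1) → ℝ) : Prop :=
  (∀ j, t j ∈ Tset N β) ∧
    ∃ τ d, IsMinimalRep N β t τ d ∧ AdmissibleWith N τ d

/-- The vertex set `V_t = {0,…,N}^τ \ W_t^τ` of the directed graph `G_t`. -/
def Vset (N : ℕ) {m : ℕ} (τ : ℕ) (d : Fin (m + 1) → ℕ → ℕ) : Set (List ℕ) :=
  Words N τ \ Wset N τ d

/-- The graph on `V` with an edge `i → j` iff `i_2 … i_τ = j_1 … j_{τ-1}` has a cycle: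
a directed path of positive length starting and ending at the same vertex. -/
def HasCycle (V : Set (List ℕ)) : Prop :=
  ∃ (L : ℕ) (p : ℕ → List ℕ), 0 < L ∧ (∀ i ≤ L, p i ∈ V) ∧
    (∀ i < L, (p i).drop 1 = (p (i + 1)).dropLast) ∧ p 0 = p L

open Classical in
/-- The adjacency matrix of the directed graph `G_t`, indexed by all words of length `τ`
over `{0,…,N}`; its `(i,j)` entry is `1` exactly when `i, j ∈ V_t` and there is a
directed edge `i → j`, and the rows and columns outside `V_t` are zero. -/
def adjMat (N τ : ℕ) (V : Set (List ℕ)) :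
    Matrix (Fin τ → Fin (N + 1)) (Fin τ → Fin (N + 1)) ℕ :=
  fun i j =>
    if (List.ofFn fun k => (i k : ℕ)) ∈ V ∧ (List.ofFn fun k => (j k : ℕ)) ∈ V ∧
        (List.ofFn fun k => (i k : ℕ)).drop 1 = (List.ofFn fun k => (j k : ℕ)).dropLast
    then 1 else 0

/-- `φ_i(x) = βx + i(1-β)/N`. -/
def phi (N : ℕ) (β : ℝ) (i : ℕ) (x : ℝ) : ℝ := β * x + i * (1 - β) / N

/-- `φ_{i_1 … i_n} = φ_{i_1} ∘ ⋯ ∘ φ_{i_n}`. -/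
def phiWord (N : ℕ) (β : ℝ) (w : List ℕ) (x : ℝ) : ℝ := w.foldr (phi N β) x

/-- The conjugate translation vector `t̂_j = t_m - t_{m-j}`. -/
def conj {m : ℕ} (t : Fin (m + 1) → ℝ) : Fin (m + 1) → ℝ :=
  fun j => t (Fin.last m) - t ⟨m - (j : ℕ), Nat.lt_succ_of_le (Nat.sub_le m j)⟩

/-- Two-sided digit bounds keep a power series summable. -/
lemma summable_digits {β : ℝ} (hβ0 : 0 < β) (hβ1 : β < 1) {N : ℕ} {c : ℕ → ℤ}
    (hc : ∀ k, c k ∈ Set.Icc 0 (N : ℤ)) : Summable fun k => (c k : ℝ) * β ^ k := by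
  refine Summable.of_nonneg_of_le (fun k => ?_) (fun k => ?_)
    ((summable_geometric_of_lt_one hβ0.le hβ1).mul_left (N : ℝ))
  · have : (0 : ℝ) ≤ c k := by exact_mod_cast (hc k).1
    positivity
  · have : (c k : ℝ) ≤ N := by exact_mod_cast (hc k).2
    gcongr

lemma Gamma_subset_Icc {N : ℕ} (hN : 0 < N) {β : ℝ} (hβ0 : 0 < β) (hβ1 : β < 1) :
    Gamma N β ⊆ Set.Icc 0 1 := by
  rintro x ⟨c, hc, rfl⟩
  have hN' : (0 : ℝ) < N := by exact_mod_cast hN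
  have h1β : 0 < 1 - β := by linarith
  constructor
  · refine mul_nonneg (by positivity) (tsum_nonneg fun k => ?_)
    have : (0 : ℝ) ≤ c k := by exact_mod_cast (hc k).1
    positivity
  · have hle : ∑' k, (c k : ℝ) * β ^ k ≤ N * (1 - β)⁻¹ := by
      rw [← tsum_geometric_of_lt_one hβ0.le hβ1, ← tsum_mul_left]
      refine (summable_digits hβ0 hβ1 hc).tsum_le_tsum (fun k => ?_)
        ((summable_geometric_of_lt_one hβ0.le hβ1).mul_left (N : ℝ))
      have : (c k : ℝ) ≤ N := by exact_mod_cast (hc k).2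
      gcongr
    calc (1 - β) / N * ∑' k, (c k : ℝ) * β ^ k ≤ (1 - β) / N * (N * (1 - β)⁻¹) := by gcongr
      _ = 1 := by field_simp

lemma zero_mem_Gamma (N : ℕ) (β : ℝ) : (0 : ℝ) ∈ Gamma N β :=
  ⟨fun _ => 0, fun _ => ⟨le_rfl, by positivity⟩, by simp⟩

lemma one_sub_mem_Gamma {N : ℕ} (hN : 0 < N) {β : ℝ} (hβ0 : 0 < β) (hβ1 : β < 1) {x : ℝ}
    (hx : x ∈ Gamma N β) : 1 - x ∈ Gamma N β := by
  obtain ⟨c, hc, rfl⟩ := hx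
  refine ⟨fun k => N - c k, fun k => ⟨by linarith [(hc k).2], by linarith [(hc k).1]⟩, ?_⟩
  have hN' : (0 : ℝ) < N := by exact_mod_cast hN
  have h1β : 0 < 1 - β := by linarith
  have hsum : ∑' k, (((N : ℤ) - c k : ℤ) : ℝ) * β ^ k
      = N * (1 - β)⁻¹ - ∑' k, (c k : ℝ) * β ^ k := by
    rw [← tsum_geometric_of_lt_one hβ0.le hβ1, ← tsum_mul_left,
      ← ((summable_geometric_of_lt_one hβ0.le hβ1).mul_left (N : ℝ)).tsum_sub
        (summable_digits hβ0 hβ1 hc)]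
    refine tsum_congr fun k => ?_
    push_cast
    ring
  rw [hsum]
  field_simp

lemma one_mem_Gamma {N : ℕ} (hN : 0 < N) {β : ℝ} (hβ0 : 0 < β) (hβ1 : β < 1) :
    (1 : ℝ) ∈ Gamma N β := by
  simpa using one_sub_mem_Gamma hN hβ0 hβ1 (zero_mem_Gamma N β)

lemma exists_phi_eq_of_mem_Gamma {N : ℕ} (hN : 0 < N) {β : ℝ} (hβ0 : 0 < β) (hβ1 : β < 1)
    {x : ℝ} (hx : x ∈ Gamma N β) : ∃ i ≤ N, ∃ y ∈ Gamma N β, phi N β i y = x := by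
  obtain ⟨c, hc, rfl⟩ := hx
  have h0 := hc 0
  refine ⟨(c 0).toNat, by have := h0.2; omega, _,
    ⟨fun k => c (k + 1), fun k => hc (k + 1), rfl⟩, ?_⟩
  have hcast : (((c 0).toNat : ℕ) : ℝ) = c 0 := by
    exact_mod_cast congrArg (Int.cast (R := ℝ)) (Int.toNat_of_nonneg h0.1)
  rw [(summable_digits hβ0 hβ1 hc).tsum_eq_zero_add, phi, hcast]
  simp_rw [pow_succ, ← mul_assoc]
  rw [tsum_mul_right]
  have hN' : (0 : ℝ) < N := by exact_mod_cast hN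
  field_simp
  ring

lemma phi_mem_Gamma {N : ℕ} (hN : 0 < N) {β : ℝ} (hβ0 : 0 < β) (hβ1 : β < 1)
    {i : ℕ} (hi : i ≤ N) {y : ℝ} (hy : y ∈ Gamma N β) : phi N β i y ∈ Gamma N β := by
  obtain ⟨c, hc, rfl⟩ := hy
  let c' : ℕ → ℤ
    | 0 => i
    | k + 1 => c k
  have hc' : ∀ k, c' k ∈ Set.Icc 0 (N : ℤ) := by
    rintro (_ | k)
    · exact ⟨Int.natCast_nonneg i, Int.ofNat_le.2 hi⟩
    · exact hc k
  refine ⟨c', hc', ?_⟩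
  rw [(summable_digits hβ0 hβ1 hc').tsum_eq_zero_add, phi]
  simp_rw [pow_succ, ← mul_assoc]
  rw [tsum_mul_right]
  have hN' : (0 : ℝ) < N := by exact_mod_cast hN
  simp only [c', Int.cast_natCast]
  field_simp
  ring

lemma phi_zero_add_gap_le {N : ℕ} {β : ℝ} (hβ1 : β < 1) {i k : ℕ} (hik : i < k) :
    phi N β i 1 + ((1 - β) / N - β) ≤ phi N β k 0 := by
  have h1 : ((i : ℝ) + 1) ≤ k := by exact_mod_cast hik
  have h2 : 0 ≤ (1 - β) / N := div_nonneg (by linarith) (by positivity)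
  have := mul_le_mul_of_nonneg_right h1 h2
  simp only [phi, mul_div_assoc]
  linarith

/-- A point of `Γ` closer than the first-level gap to a first-level piece, on its right,
is in that piece. -/
lemma mem_Icc_phi_of_lt_gap {N : ℕ} (hN : 0 < N) {β : ℝ} (hβ0 : 0 < β) (hβ1 : β < 1)
    {i : ℕ} {u v : ℝ} (hu : u ∈ Set.Icc (phi N β i 0) (phi N β i 1)) (hv : v ∈ Gamma N β)
    (huv : u ≤ v) (hvu : v < u + ((1 - β) / N - β)) :
    v ∈ Set.Icc (phi N β i 0) (phi N β i 1) := by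
  obtain ⟨k, -, y, hy, rfl⟩ := exists_phi_eq_of_mem_Gamma hN hβ0 hβ1 hv
  have hy01 := Gamma_subset_Icc hN hβ0 hβ1 hy
  have hv0 : phi N β k 0 ≤ phi N β k y := by
    have := mul_le_mul_of_nonneg_left hy01.1 hβ0.le
    simp only [phi]; linarith
  have hv1 : phi N β k y ≤ phi N β k 1 := by
    have := mul_le_mul_of_nonneg_left hy01.2 hβ0.le
    simp only [phi]; linarith
  rcases lt_trichotomy i k with hlt | rfl | hlt
  · linarith [phi_zero_add_gap_le (N := N) hβ1 hlt, hu.2]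
  · exact ⟨hv0, hv1⟩
  · linarith [phi_zero_add_gap_le (N := N) hβ1 hlt, hu.1]

/-- A strictly contracted copy of `Γ` inside `Γ` lies in a single first-level piece. -/
lemma exists_forall_mem_Icc_phi {N : ℕ} (hN : 0 < N) {β : ℝ} (hβ0 : 0 < β)
    (hβ1 : β < 1) (hgap : β < (1 - β) / N - β) {r a : ℝ} (hr0 : 0 < r) (hr1 : r < 1)
    (h : ∀ x ∈ Gamma N β, r * x + a ∈ Gamma N β) :
    ∃ i ≤ N, ∀ x ∈ Gamma N β, r * x + a ∈ Set.Icc (phi N β i 0) (phi N β i 1) := by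
  obtain ⟨i, hi, y, hy, hyx⟩ :=
    exists_phi_eq_of_mem_Gamma hN hβ0 hβ1 (h 0 (zero_mem_Gamma N β))
  have hy01 := Gamma_subset_Icc hN hβ0 hβ1 hy
  have h0 : r * 0 + a ∈ Set.Icc (phi N β i 0) (phi N β i 1) := by
    rw [← hyx]
    constructor
    · have := mul_le_mul_of_nonneg_left hy01.1 hβ0.le
      simp only [phi]; linarith
    · have := mul_le_mul_of_nonneg_left hy01.2 hβ0.le
      simp only [phi]; linarith
  have hstep : ∀ p q : ℝ, p ≤ q → q ≤ p + ((1 - β) / N - β) → q ∈ Gamma N β →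
      r * p + a ∈ Set.Icc (phi N β i 0) (phi N β i 1) →
      r * q + a ∈ Set.Icc (phi N β i 0) (phi N β i 1) := by
    intro p q hpq hqp hq hp
    refine mem_Icc_phi_of_lt_gap hN hβ0 hβ1 hp (h q hq) (by gcongr) ?_
    have h1 : r * (q - p) ≤ r * ((1 - β) / N - β) := by
      exact mul_le_mul_of_nonneg_left (by linarith) hr0.le
    have h2 : r * ((1 - β) / N - β) < 1 * ((1 - β) / N - β) := by
      gcongr; linarith
    linarith
  have hright : ∀ k ≤ N, r * phi N β k 0 + a ∈ Set.Icc (phi N β i 0) (phi N β i 1) →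
      r * phi N β k 1 + a ∈ Set.Icc (phi N β i 0) (phi N β i 1) := by
    intro k hk
    refine hstep _ _ ?_ ?_ (phi_mem_Gamma hN hβ0 hβ1 hk (one_mem_Gamma hN hβ0 hβ1)) <;>
    · simp only [phi]; linarith
  have hleft : ∀ k ≤ N, r * phi N β k 0 + a ∈ Set.Icc (phi N β i 0) (phi N β i 1) := by
    intro k
    induction k with
    | zero => intro _; simpa [phi] using h0
    | succ k ih =>
      intro hk
      refine hstep _ _ ?_ ?_ (phi_mem_Gamma hN hβ0 hβ1 hk (zero_mem_Gamma N β))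
        (hright k (by omega) (ih (by omega)))
      · linarith [phi_zero_add_gap_le (N := N) hβ1 k.lt_succ_self]
      · simp only [phi, mul_div_assoc]; push_cast; linarith
  have h1 := hright N le_rfl (hleft N le_rfl)
  have hone : phi N β N 1 = 1 := by
    have hN' : (0 : ℝ) < N := by exact_mod_cast hN
    simp only [phi]; field_simp; ring
  rw [hone] at h1
  refine ⟨i, hi, fun x hx => ?_⟩
  have hx01 := Gamma_subset_Icc hN hβ0 hβ1 hx
  have e1 := mul_le_mul_of_nonneg_left hx01.1 hr0.le
  have e2 := mul_le_mul_of_nonneg_left hx01.2 hr0.le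
  exact ⟨by linarith [h0.1], by linarith [h1.2]⟩

/-- An orientation-preserving similar copy of `Γ` inside `Γ` is a cylinder of `Γ`. -/
lemma exists_word_of_image_subset_Gamma {N : ℕ} (hN : 0 < N) {β : ℝ} (hβ0 : 0 < β)
    (hβ1 : β < 1) (hgap : β < (1 - β) / N - β) {r a : ℝ} (hr0 : 0 < r)
    (h : ∀ x ∈ Gamma N β, r * x + a ∈ Gamma N β) :
    ∃ n, ∃ w ∈ Words N n, r = β ^ n ∧ ∀ x, r * x + a = phiWord N β w x := by
  obtain ⟨k, hk⟩ := exists_pow_lt_of_lt_one hr0 hβ1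
  induction k generalizing r a with
  | zero =>
    have e0 := (Gamma_subset_Icc hN hβ0 hβ1 (h 0 (zero_mem_Gamma N β))).1
    have e1 := (Gamma_subset_Icc hN hβ0 hβ1 (h 1 (one_mem_Gamma hN hβ0 hβ1))).2
    rw [pow_zero] at hk
    linarith
  | succ k ih =>
    have e0 := (Gamma_subset_Icc hN hβ0 hβ1 (h 0 (zero_mem_Gamma N β))).1
    have e1 := (Gamma_subset_Icc hN hβ0 hβ1 (h 1 (one_mem_Gamma hN hβ0 hβ1))).2
    rcases (show r ≤ 1 by linarith).eq_or_lt with rfl | hr1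
    · obtain rfl : a = 0 := by linarith
      exact ⟨0, [], by simp [Words], by simp, by simp [phiWord]⟩
    obtain ⟨i, hi, hmem⟩ := exists_forall_mem_Icc_phi hN hβ0 hβ1 hgap hr0 hr1 h
    have hscale : ∀ x, β * (r / β * x + (a - i * (1 - β) / N) / β) + i * (1 - β) / N
        = r * x + a := fun x => by field_simp; ring
    have hmaps : ∀ x ∈ Gamma N β, r / β * x + (a - i * (1 - β) / N) / β ∈ Gamma N β := by
      intro x hx
      obtain ⟨l, -, y, hy, hyx⟩ := exists_phi_eq_of_mem_Gamma hN hβ0 hβ1 (h x hx)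
      have hy01 := Gamma_subset_Icc hN hβ0 hβ1 hy
      have f1 := mul_le_mul_of_nonneg_left hy01.1 hβ0.le
      have f2 := mul_le_mul_of_nonneg_left hy01.2 hβ0.le
      have hm := hmem x hx
      rw [← hyx] at hm
      obtain rfl : l = i := by
        rcases lt_trichotomy l i with hlt | rfl | hlt
        · have h3 := phi_zero_add_gap_le (N := N) hβ1 hlt
          simp only [phi, Set.mem_Icc] at h3 hm
          linarith [hm.1]
        · rfl
        · have h3 := phi_zero_add_gap_le (N := N) hβ1 hlt
          simp only [phi, Set.mem_Icc] at h3 hm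
          linarith [hm.2]
      have : r / β * x + (a - l * (1 - β) / N) / β = y := by
        refine mul_left_cancel₀ hβ0.ne' ?_
        have := hscale x
        rw [← hyx, phi] at this
        linarith
      rwa [this]
    obtain ⟨n, w, hw, hr, hx⟩ := ih (by positivity) hmaps
      ((lt_div_iff₀ hβ0).2 (by rwa [← pow_succ]))
    refine ⟨n + 1, i :: w, ⟨by simp [hw.1], by simpa using ⟨hi, hw.2⟩⟩, ?_, fun x => ?_⟩
    · rw [pow_succ, ← hr]; field_simp
    · rw [← hscale, hx]; rfl

lemma phiWord_eq (N : ℕ) (β : ℝ) (w : List ℕ) (x : ℝ) :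
    phiWord N β w x = β ^ w.length * x
      + (1 - β) / N * ∑ k ∈ Finset.range w.length, (w.getD k 0 : ℝ) * β ^ k := by
  induction w with
  | nil => simp [phiWord]
  | cons i w ih =>
    have hcons : phiWord N β (i :: w) x = phi N β i (phiWord N β w x) := rfl
    rw [hcons, ih, List.length_cons, Finset.sum_range_succ', phi]
    simp_rw [pow_succ, ← mul_assoc]
    rw [← Finset.sum_mul]
    simp only [List.getD_cons_succ, List.getD_cons_zero, pow_zero]
    ring

/-- Integer digits of absolute value at most `M` are determined by the value in base
`β < 1 / (M + 1)`. -/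
lemma digits_eq_zero_of_sum_eq_zero {M : ℕ} {β : ℝ} (hβ0 : 0 < β) (hβ : β * (M + 1) < 1)
    {L : ℕ} {e : ℕ → ℤ} (he : ∀ l < L, |e l| ≤ M)
    (hsum : ∑ l ∈ Finset.range L, (e l : ℝ) * β ^ l = 0) : ∀ l < L, e l = 0 := by
  have hβ1 : β < 1 := by nlinarith [mul_nonneg hβ0.le (Nat.cast_nonneg (α := ℝ) M)]
  induction L generalizing e with
  | zero => intro l hl; omega
  | succ L ih =>
    rw [Finset.sum_range_succ'] at hsum
    simp_rw [pow_succ, ← mul_assoc] at hsum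
    rw [← Finset.sum_mul, pow_zero, mul_one] at hsum
    set S := ∑ l ∈ Finset.range L, (e (l + 1) : ℝ) * β ^ l with hS
    have hSle : |S| ≤ M * (1 - β)⁻¹ := by
      calc |S| ≤ ∑ l ∈ Finset.range L, |(e (l + 1) : ℝ) * β ^ l| :=
            Finset.abs_sum_le_sum_abs _ _
        _ ≤ ∑ l ∈ Finset.range L, M * β ^ l := by
            refine Finset.sum_le_sum fun l hl => ?_
            rw [abs_mul, abs_of_pos (pow_pos hβ0 l)]
            have : |(e (l + 1) : ℝ)| ≤ M := by
              exact_mod_cast he (l + 1) (by simpa using hl)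
            gcongr
        _ = M * ∑ l ∈ Finset.range L, β ^ l := by rw [Finset.mul_sum]
        _ ≤ M * (1 - β)⁻¹ := by
            gcongr
            rw [← tsum_geometric_of_lt_one hβ0.le hβ1]
            exact (summable_geometric_of_lt_one hβ0.le hβ1).sum_le_tsum _
              fun l _ => by positivity
    have he0 : e 0 = 0 := by
      rw [← Int.abs_lt_one_iff]
      have h1 : |(e 0 : ℝ)| = |S| * β := by
        rw [show (e 0 : ℝ) = -(S * β) by linarith, abs_neg, abs_mul, abs_of_pos hβ0]
      have h2 : |S| * β ≤ M * (1 - β)⁻¹ * β := by gcongr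
      have h3 : M * (1 - β)⁻¹ * β < 1 := by
        rw [mul_right_comm, ← div_eq_mul_inv, div_lt_one (by linarith)]
        linarith
      have : |(e 0 : ℝ)| < 1 := by linarith
      exact_mod_cast this
    have hS0 : S = 0 := by
      rw [he0, Int.cast_zero, add_zero] at hsum
      exact (mul_eq_zero.1 hsum).resolve_right hβ0.ne'
    rintro (_ | l) hl
    · exact he0
    · exact ih (e := fun l => e (l + 1)) (fun l hl => he (l + 1) (by omega)) hS0 l (by omega)

/-- If `p - q` and the reversed digits `c` (read from position `n` leftwards) have the same
value in base `β`, then the digits agree. -/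
lemma digits_eq_of_sum_eq {N : ℕ} {β : ℝ} (hβ0 : 0 < β) (hβ : β * (2 * N + 1) < 1)
    {n τ : ℕ} {p q c : ℕ → ℕ} (hp : ∀ k, p k ≤ N) (hq : ∀ k, q k ≤ N) (hc : ∀ k, c k ≤ N)
    (hsum : ∑ k ∈ Finset.range n, (p k : ℝ) * β ^ k - ∑ k ∈ Finset.range n, (q k : ℝ) * β ^ k
      = β ^ n * ∑ k ∈ Finset.Icc 1 τ, (c k : ℝ) * β ^ (-(k : ℤ))) :
    ∀ k, 1 ≤ k → k ≤ τ → (k ≤ n → p (n - k) = q (n - k) + c k) ∧ (n < k → c k = 0) := by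
  let A : ℕ → ℤ := fun l => if τ ≤ l then (p (l - τ) : ℤ) - q (l - τ) else 0
  let B : ℕ → ℤ := fun l => if n ≤ l then (c (n + τ - l) : ℤ) else 0
  have hA : ∑ l ∈ Finset.range (n + τ), (A l : ℝ) * β ^ l
      = β ^ τ * (∑ k ∈ Finset.range n, (p k : ℝ) * β ^ k
        - ∑ k ∈ Finset.range n, (q k : ℝ) * β ^ k) := by
    rw [add_comm n τ, Finset.sum_range_add, Finset.sum_eq_zero, zero_add,
      ← Finset.sum_sub_distrib, Finset.mul_sum]
    · refine Finset.sum_congr rfl fun k _ => ?_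
      simp [A, pow_add]
      ring
    · intro l hl
      have : ¬ τ ≤ l := by simpa using hl
      simp [A, this]
  have hB : ∑ l ∈ Finset.range (n + τ), (B l : ℝ) * β ^ l
      = β ^ τ * (β ^ n * ∑ k ∈ Finset.Icc 1 τ, (c k : ℝ) * β ^ (-(k : ℤ))) := by
    rw [Finset.sum_range_add, Finset.sum_eq_zero, zero_add, ← mul_assoc, Finset.mul_sum]
    · refine Finset.sum_bij' (fun l _ => τ - l) (fun k _ => τ - k) ?_ ?_ ?_ ?_ ?_
      · intro l hl; simp at hl ⊢; omega
      · intro l hl; simp at hl ⊢; omega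
      · intro l hl; simp at hl ⊢; omega
      · intro l hl; simp at hl ⊢; omega
      · intro l hl
        have hl' : l < τ := by simpa using hl
        have e1 : n + τ - (n + l) = τ - l := by omega
        have e2 : β ^ τ * β ^ (-((τ - l : ℕ) : ℤ)) = β ^ l := by
          rw [← zpow_natCast, ← zpow_add₀ hβ0.ne', ← zpow_natCast]
          congr 1
          omega
        simp only [B, le_add_iff_nonneg_right, zero_le, if_true, e1, Int.cast_natCast]
        rw [pow_add, ← e2]
        ring
    · intro l hl
      have : ¬ n ≤ l := by simpa using hl
      simp [B, this]
  have hzero := digits_eq_zero_of_sum_eq_zero (M := 2 * N) hβ0 (by push_cast; exact hβ)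
    (L := n + τ) (e := fun l => A l - B l) ?_ ?_
  · intro k hk1 hkτ
    have hk := hzero (n + τ - k) (by omega)
    have e1 : n + τ - (n + τ - k) = k := by omega
    simp only [A, B, e1, if_pos (show n ≤ n + τ - k by omega)] at hk
    refine ⟨fun hkn => ?_, fun hkn => ?_⟩
    · rw [if_pos (by omega), show n + τ - k - τ = n - k by omega] at hk
      omega
    · rw [if_neg (by omega)] at hk
      omega
  · intro l _
    have h1 := hp (l - τ)
    have h2 := hq (l - τ)
    have h3 := hc (n + τ - l)
    simp only [A, B, abs_le]
    split_ifs <;> constructor <;> push_cast <;> omega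
  · simp only [Int.cast_sub, sub_mul, Finset.sum_sub_distrib]
    rw [hA, hB, hsum, sub_self]

lemma getD_le_of_mem_Words {N n : ℕ} {w : List ℕ} (hw : w ∈ Words N n) (k : ℕ) :
    w.getD k 0 ≤ N := by
  rcases lt_or_ge k w.length with hk | hk
  · rw [List.getD_eq_getElem _ _ hk]
    exact hw.2 _ (List.getElem_mem hk)
  · rw [List.getD_eq_default _ _ hk]
    exact N.zero_le

/-- Suppose `0 < β < 1/(2N+1)`, `t = (t_0,…,t_m) ∈ T^{m+1}` with `0 = t_0 < ⋯ < t_m`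
(with minimal digit representation `d` of length `τ = τ_t`), and `g(x) = -r x + b` with
`0 < r < 1`. If `g(Γ_t) ⊆ Γ`, then `g(x) = φ_i(1 - x)` for some word `i ∈ Ω̂_t^n` with
`n ≥ τ_t`. -/
theorem stmt13 (N : ℕ) (hN : 0 < N) (β : ℝ) (hβ0 : 0 < β) (hβ1 : β < 1 / (2 * N + 1))
    (m : ℕ) (t : Fin (m + 1) → ℝ) (ht0 : t 0 = 0) (hmono : StrictMono t)
    (hT : ∀ j, t j ∈ Tset N β) (τ : ℕ) (d : Fin (m + 1) → ℕ → ℕ)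
    (hd : IsMinimalRep N β t τ d)
    (r b : ℝ) (hr0 : 0 < r) (hr1 : r < 1)
    (h : ∀ x ∈ GammaT N β t, -r * x + b ∈ Gamma N β) :
    ∃ n, τ ≤ n ∧ ∃ w ∈ OmegaHat N τ (digitSup d) n,
      ∀ x : ℝ, -r * x + b = phiWord N β w (1 - x) := by
  have hN' : (0 : ℝ) < N := by exact_mod_cast hN
  have hβ2 : β * (2 * N + 1) < 1 := (lt_div_iff₀ (by positivity)).1 hβ1
  have hβ' : β < 1 := by nlinarith [mul_pos hβ0 hN']
  have hgap : β < (1 - β) / N - β := by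
    rw [lt_sub_iff_add_lt, lt_div_iff₀ hN']
    linarith
  have hword : ∀ j, ∃ n, ∃ w ∈ Words N n, r = β ^ n ∧
      ∀ x, r * x + (b - r - r * t j) = phiWord N β w x := fun j => by
    refine exists_word_of_image_subset_Gamma hN hβ0 hβ' hgap hr0 fun x hx => ?_
    have := h (1 - x + t j)
      (Set.mem_iUnion.2 ⟨j, _, one_sub_mem_Gamma hN hβ0 hβ' hx, rfl⟩)
    convert this using 1
    ring
  obtain ⟨n, w, hw, hrn, hwx⟩ := hword 0
  have hdig : ∀ j, ∃ w' : List ℕ, ∀ k, 1 ≤ k → k ≤ τ →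
      (k ≤ n → w.getD (n - k) 0 = w'.getD (n - k) 0 + d j k) ∧ (n < k → d j k = 0) := by
    intro j
    obtain ⟨n', w', hw', hrn', hwx'⟩ := hword j
    obtain rfl : n = n' := pow_right_injective₀ hβ0 hβ'.ne (hrn.symm.trans hrn')
    refine ⟨w', digits_eq_of_sum_eq hβ0 hβ2 (getD_le_of_mem_Words hw)
      (getD_le_of_mem_Words hw') (hd.1.1 j) ?_⟩
    have e := hwx 0
    have e' := hwx' 0
    rw [phiWord_eq, hw.1, ht0] at e
    rw [phiWord_eq, hw'.1, hd.1.2 j] at e'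
    have hc : (1 - β) / N ≠ 0 := (div_pos (by linarith) hN').ne'
    refine mul_left_cancel₀ hc ?_
    rw [← hrn]
    linarith
  have hτn : τ ≤ n := by
    by_contra! hlt
    refine hd.2 n hlt d ⟨hd.1.1, fun j => ?_⟩
    rw [hd.1.2 j]
    congr 1
    symm
    refine Finset.sum_subset (Finset.Icc_subset_Icc_right hlt.le) fun k hk hk' => ?_
    obtain ⟨w', hw'⟩ := hdig j
    simp only [Finset.mem_Icc] at hk hk'
    rw [(hw' k hk.1 hk.2).2 (by omega), Nat.cast_zero, zero_mul]
  refine ⟨n, hτn, w, ⟨hw, fun k hk1 hkτ => ?_⟩, fun x => ?_⟩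
  · refine Finset.sup_le fun j _ => ?_
    obtain ⟨w', hw'⟩ := hdig j
    have := (hw' k hk1 hkτ).1 (hkτ.trans hτn)
    omega
  · rw [← hwx, ht0]
    ring

end HSCantor
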